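/- Fix α ∈ (0,1). Assume G and G' are bounded on [−1,∞), lim_{|θ|→∞} Σ_k min(p_k, p_k(θ)) = 0, and (q̄_L)_{L∈ℕ} ⊆ Γ satisfies lim_{L→∞} Σ_k min(q̄_{L,k}, p_k) = 0 and, for every c > 0, lim_{L→∞} sup_{|θ|≤c} Σ_k min(q̄_{L,k}, p_k(θ)) = 0. Suppose there exists δ > 0 such that inf_{L∈ℕ} inf_{θ∈Θ} D(αq̄_L, θ) > inf_{θ∈Θ} D((1−α)p, θ) + δ, and that for each L the minimizer T((1−α)p + αq̄_L) = argmin_{θ∈Θ} D((1−α)p + αq̄_L, θ) exists. Then there exists L₀ ∈ ℕ such that for every λ ∈ (0,δ) there is M* > 0 with inf_{L>L₀} inf_{θ∈Θ, |θ|>M*} ( D((1−α)p + αq̄_L, θ) − D((1−α)p + αq̄_L, T((1−α)p + αq̄_L)) ) ≥ λ. -/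

import Mathlib

open MeasureTheory Filter Topology Set

/-- Pearson residual. -/
noncomputable def pearson (f : ℝ → ℕ → ℝ) (q : ℕ → ℝ) (θ : ℝ) (k : ℕ) : ℝ :=
  if 0 < f θ k then q k / f θ k - 1 else 0

/-- Disparity `D(q,θ) = Σ_k G(δ(q,θ,k)) p_k(θ)` (applied verbatim to any sequence). -/
noncomputable def disparity (G : ℝ → ℝ) (f : ℝ → ℕ → ℝ) (q : ℕ → ℝ) (θ : ℝ) : ℝ :=
  ∑' k, G (pearson f q θ k) * f θ k

/-- Probability mass function on ℕ. -/
def IsPMF (q : ℕ → ℝ) : Prop := (∀ k, 0 ≤ q k) ∧ ∑' k, q k = 1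

/-- A convex function that is bounded above on a right half-line is nonincreasing there. -/
lemma ConvexOn.antitoneOn_Ici_of_le {G : ℝ → ℝ} {c B : ℝ} (hG : ConvexOn ℝ (Set.Ici c) G)
    (hB : ∀ x, c ≤ x → G x ≤ B) : AntitoneOn G (Set.Ici c) := by
  intro a ha b hb hab
  by_contra! h
  have hlt : a < b := lt_of_le_of_ne hab (by rintro rfl; exact lt_irrefl _ h)
  set s := (G b - G a) / (b - a) with hs
  have hs0 : 0 < s := div_pos (by linarith) (by linarith)
  have hBb : G b ≤ B := hB b hb
  set t := (B - G b + 1) / s with ht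
  have ht0 : 0 < t := div_pos (by linarith) hs0
  have hz : c ≤ b + t := by have : c ≤ b := hb; linarith
  have hslope := hG.slope_mono_adjacent ha (Set.mem_Ici.2 hz) hlt (by linarith : b < b + t)
  rw [← hs, add_sub_cancel_left, le_div_iff₀ ht0, ht, mul_div_cancel₀ _ hs0.ne'] at hslope
  linarith [hB _ hz]

/-- One-sided Lipschitz bound from a bound on the derivative, up to the boundary point. -/
lemma sub_add_le_of_abs_deriv_le {G : ℝ → ℝ} {c K : ℝ} (hd : DifferentiableOn ℝ G (Set.Ici c))
    (hK : ∀ x, c ≤ x → |deriv G x| ≤ K) {v u : ℝ} (hv : c ≤ v) (hu : 0 ≤ u) :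
    G v - G (v + u) ≤ K * u := by
  rcases hu.eq_or_lt with rfl | hu
  · simp
  have hsub : Set.Icc v (v + u) ⊆ Set.Ici c := fun x hx => hv.trans hx.1
  obtain ⟨x, hx, hxd⟩ := exists_deriv_eq_slope G (by linarith : v < v + u)
    (hd.continuousOn.mono hsub) (hd.mono (Set.Ioo_subset_Icc_self.trans hsub))
  rw [add_sub_cancel_left, eq_div_iff hu.ne'] at hxd
  have hlow := (abs_le.1 (hK x (hv.trans hx.1.le))).1
  nlinarith

lemma neg_one_le_pearson {f : ℝ → ℕ → ℝ} {q : ℕ → ℝ} (hq : ∀ k, 0 ≤ q k) (θ : ℝ) (k : ℕ) :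
    -1 ≤ pearson f q θ k := by
  unfold pearson
  split_ifs with h
  · linarith [div_nonneg (hq k) h.le]
  · norm_num

lemma summable_disparity {G : ℝ → ℝ} {f : ℝ → ℕ → ℝ} {q : ℕ → ℝ} {θ B : ℝ}
    (hB : ∀ x, -1 ≤ x → |G x| ≤ B) (hf : ∀ k, 0 ≤ f θ k) (hfs : Summable (f θ))
    (hq : ∀ k, 0 ≤ q k) : Summable fun k => G (pearson f q θ k) * f θ k := by
  refine Summable.of_norm_bounded (hfs.mul_left B) fun k => ?_
  rw [Real.norm_eq_abs, abs_mul, abs_of_nonneg (hf k)]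
  exact mul_le_mul_of_nonneg_right (hB _ (neg_one_le_pearson hq θ k)) (hf k)

/-- If `G` is nonincreasing, adding mass decreases the disparity. -/
lemma disparity_add_le {G : ℝ → ℝ} {f : ℝ → ℕ → ℝ} {r q : ℕ → ℝ} {θ B : ℝ}
    (hanti : AntitoneOn G (Set.Ici (-1)))
    (hB : ∀ x, -1 ≤ x → |G x| ≤ B) (hf : ∀ k, 0 ≤ f θ k) (hfs : Summable (f θ))
    (hr : ∀ k, 0 ≤ r k) (hq : ∀ k, 0 ≤ q k) :
    disparity G f (fun k => r k + q k) θ ≤ disparity G f r θ := by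
  have hrq : ∀ k, 0 ≤ r k + q k := fun k => add_nonneg (hr k) (hq k)
  refine (summable_disparity hB hf hfs hrq).tsum_le_tsum (fun k => ?_)
    (summable_disparity hB hf hfs hr)
  refine mul_le_mul_of_nonneg_right (hanti (neg_one_le_pearson hr θ k)
    (neg_one_le_pearson hrq θ k) ?_) (hf k)
  unfold pearson
  split_ifs with h
  · gcongr
    linarith [hq k]
  · exact le_rfl

/-- Adding mass `r` decreases the disparity by at most a multiple of the overlap of the model
with any `p ≥ r`. -/
lemma disparity_sub_add_le {G : ℝ → ℝ} {f : ℝ → ℕ → ℝ} {p r q : ℕ → ℝ} {θ B K : ℝ}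
    (hd : DifferentiableOn ℝ G (Set.Ici (-1)))
    (hB : ∀ x, -1 ≤ x → |G x| ≤ B) (hK : ∀ x, -1 ≤ x → |deriv G x| ≤ K)
    (hf : ∀ k, 0 ≤ f θ k) (hfs : Summable (f θ))
    (hr : ∀ k, 0 ≤ r k) (hrp : ∀ k, r k ≤ p k) (hq : ∀ k, 0 ≤ q k) :
    disparity G f q θ - disparity G f (fun k => r k + q k) θ ≤
      (K + 2 * B) * ∑' k, min (p k) (f θ k) := by
  have hrq : ∀ k, 0 ≤ r k + q k := fun k => add_nonneg (hr k) (hq k)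
  have hs := summable_disparity hB hf hfs hq
  have hs' := summable_disparity hB hf hfs hrq
  have hB0 : 0 ≤ B := (abs_nonneg _).trans (hB (-1) le_rfl)
  have hK0 : 0 ≤ K := (abs_nonneg _).trans (hK (-1) le_rfl)
  have hp : ∀ k, 0 ≤ p k := fun k => (hr k).trans (hrp k)
  have hmin : Summable fun k => min (p k) (f θ k) :=
    Summable.of_nonneg_of_le (fun k => le_min (hp k) (hf k)) (fun k => min_le_right _ _) hfs
  unfold disparity
  rw [← hs.tsum_sub hs', ← tsum_mul_left]
  refine (hs.sub hs').tsum_le_tsum (fun k => ?_) (hmin.mul_left _)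
  rcases (hf k).eq_or_lt with h0 | hpos
  · simp [← h0, hp k]
  rw [← sub_mul]
  rcases min_cases (p k) (f θ k) with ⟨h, -⟩ | ⟨h, -⟩ <;> rw [h]
  · have hlip := sub_add_le_of_abs_deriv_le hd hK (neg_one_le_pearson (f := f) hq θ k)
      (div_nonneg (hr k) hpos.le)
    have heq : pearson f (fun k => r k + q k) θ k = pearson f q θ k + r k / f θ k := by
      simp only [pearson, if_pos hpos]
      ring
    rw [heq]
    calc _ ≤ K * (r k / f θ k) * f θ k := mul_le_mul_of_nonneg_right hlip hpos.le
      _ = K * r k := by field_simp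
      _ ≤ K * p k := mul_le_mul_of_nonneg_left (hrp k) hK0
      _ ≤ (K + 2 * B) * p k := mul_le_mul_of_nonneg_right (by linarith) (hp k)
  · refine mul_le_mul_of_nonneg_right ?_ hpos.le
    have h₁ := abs_le.1 (hB _ (neg_one_le_pearson (f := f) hq θ k))
    have h₂ := abs_le.1 (hB _ (neg_one_le_pearson (f := f) hrq θ k))
    linarith [h₁.2, h₂.1]

/-- Lemma 2: under the gap condition
`inf_L inf_θ D(αq̄_L,θ) > inf_θ D((1−α)p,θ) + δ`, for every `λ ∈ (0,δ)` the disparity of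
the contaminated mixture exceeds its minimum value by at least `λ` uniformly far out. -/
theorem stmt18 (Θ : Set ℝ)
    (f : ℝ → ℕ → ℝ) (G : ℝ → ℝ)
    (α : ℝ) (hα0 : 0 < α) (hα1 : α < 1)
    (hf_pmf : ∀ θ ∈ Θ, (∀ k, 0 ≤ f θ k) ∧ ∑' k, f θ k = 1)
    (hG : StrictConvexOn ℝ (Set.Ici (-1 : ℝ)) G)
    (hG3 : ContDiffOn ℝ 3 G (Set.Ici (-1 : ℝ))) (hG0 : G 0 = 0)
    (hG_bdd : ∃ M, ∀ x : ℝ, -1 ≤ x → |G x| ≤ M)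
    (hG'_bdd : ∃ M, ∀ x : ℝ, -1 ≤ x → |deriv G x| ≤ M)
    (p : ℕ → ℝ) (hp_pmf : IsPMF p)
    (hortho_family : ∀ ε > 0, ∃ M, ∀ θ ∈ Θ, M < |θ| →
      (∑' k, min (p k) (f θ k)) < ε)
    (qbar : ℕ → ℕ → ℝ) (hqbar : ∀ L, IsPMF (qbar L))
    (hortho_contam : Tendsto (fun L => ∑' k, min (qbar L k) (p k)) atTop (𝓝 0))
    (hortho_contam_family : ∀ c > 0, ∀ ε > 0, ∃ L₂ : ℕ, ∀ L ≥ L₂, ∀ θ ∈ Θ, |θ| ≤ c →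
      (∑' k, min (qbar L k) (f θ k)) < ε)
    (δ : ℝ) (hδ : 0 < δ)
    (hgap : ∀ L : ℕ, ∀ θ ∈ Θ,
      sInf (disparity G f (fun k => (1 - α) * p k) '' Θ) + δ <
        disparity G f (fun k => α * qbar L k) θ)
    (TL : ℕ → ℝ) (hTL_mem : ∀ L, TL L ∈ Θ)
    (hTL_min : ∀ L, ∀ θ ∈ Θ,
      disparity G f (fun k => (1 - α) * p k + α * qbar L k) (TL L) ≤
        disparity G f (fun k => (1 - α) * p k + α * qbar L k) θ) :
    ∃ L₀ : ℕ, ∀ lam : ℝ, 0 < lam → lam < δ → ∃ M > 0, ∀ L > L₀, ∀ θ ∈ Θ, M < |θ| →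
      lam ≤ disparity G f (fun k => (1 - α) * p k + α * qbar L k) θ -
        disparity G f (fun k => (1 - α) * p k + α * qbar L k) (TL L) := by
  obtain ⟨B, hB⟩ := hG_bdd
  obtain ⟨K, hK⟩ := hG'_bdd
  have hanti : AntitoneOn G (Set.Ici (-1)) :=
    hG.convexOn.antitoneOn_Ici_of_le fun x hx => (le_abs_self _).trans (hB x hx)
  have hd : DifferentiableOn ℝ G (Set.Ici (-1)) := hG3.differentiableOn (by norm_num)
  have hfs : ∀ θ ∈ Θ, Summable (f θ) := fun θ hθ =>
    by_contra fun h => by simpa [tsum_eq_zero_of_not_summable h] using (hf_pmf θ hθ).2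
  have hr : ∀ k, 0 ≤ (1 - α) * p k := fun k => mul_nonneg (by linarith) (hp_pmf.1 k)
  have hrp : ∀ k, (1 - α) * p k ≤ p k := fun k =>
    mul_le_of_le_one_left (hp_pmf.1 k) (by linarith)
  have hq : ∀ L k, 0 ≤ α * qbar L k := fun L k => mul_nonneg hα0.le ((hqbar L).1 k)
  have hB0 : 0 ≤ B := (abs_nonneg _).trans (hB (-1) le_rfl)
  have hK0 : 0 ≤ K := (abs_nonneg _).trans (hK (-1) le_rfl)
  have hTL_le : ∀ L, disparity G f (fun k => (1 - α) * p k + α * qbar L k) (TL L) ≤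
      sInf (disparity G f (fun k => (1 - α) * p k) '' Θ) := by
    refine fun L => le_csInf ⟨_, TL L, hTL_mem L, rfl⟩ ?_
    rintro _ ⟨θ, hθ, rfl⟩
    exact (hTL_min L θ hθ).trans
      (disparity_add_le hanti hB (hf_pmf θ hθ).1 (hfs θ hθ) hr (hq L))
  refine ⟨0, fun lam _ hlam => ?_⟩
  have hC : 0 < K + 2 * B + 1 := by linarith
  obtain ⟨M, hM⟩ := hortho_family ((δ - lam) / (K + 2 * B + 1)) (div_pos (by linarith) hC)
  refine ⟨max M 1, by positivity, fun L _ θ hθ hMθ => ?_⟩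
  have hoverlap := hM θ hθ ((le_max_left _ _).trans_lt hMθ)
  rw [lt_div_iff₀ hC] at hoverlap
  have h0 : 0 ≤ ∑' k, min (p k) (f θ k) :=
    tsum_nonneg fun k => le_min (hp_pmf.1 k) ((hf_pmf θ hθ).1 k)
  have hfar := disparity_sub_add_le hd hB hK (hf_pmf θ hθ).1 (hfs θ hθ) hr hrp (hq L)
  linarith [hTL_le L, hgap L θ hθ]
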